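/- arXiv:2303.00220 — 2 statements merged into one kernel-verified Lean document; each statement's English description precedes it below -/
import Mathlib

section
/- Let r ≥ 0 be a finite integer, let F : ℝ² → ℝ be a function of class C^r, and let B ⊂ ℝ² be a closed ball centered at the origin. Then for every n ∈ ℕ (n ≥ 1) there exists a real polynomial R_n in two variables such that |∂^{i+j}F/∂x^i∂y^j (x,y) − ∂^{i+j}R_n/∂x^i∂y^j (x,y)| < 1/n for all (x,y) ∈ B and all (i,j) ∈ ℤ²_{≥0} with i + j ≤ r. -/
/-- Partial derivative in the first variable. -/
noncomputable def pd1 (f : ℝ → ℝ → ℝ) : ℝ → ℝ → ℝ :=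
  fun x y => deriv (fun x' => f x' y) x

/-- Partial derivative in the second variable. -/
noncomputable def pd2 (f : ℝ → ℝ → ℝ) : ℝ → ℝ → ℝ :=
  fun x y => deriv (fun y' => f x y') y

/-- Mixed partial derivative `∂^{i+j} f / ∂x^{i} ∂y^{j}`. -/
noncomputable def pdMix (i j : ℕ) (f : ℝ → ℝ → ℝ) : ℝ → ℝ → ℝ :=
  pd1^[i] (pd2^[j] f)

open MeasureTheory Filter Topology Metric Function
open scoped Convolution

lemma uncurry_pd1 (f : ℝ → ℝ → ℝ) (hf : Differentiable ℝ (uncurry f)) :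
    uncurry (pd1 f) = fun p => fderiv ℝ (uncurry f) p (1, 0) := by
  ext ⟨x, y⟩
  exact ((hf (x, y)).hasFDerivAt.comp_hasDerivAt (f := fun x' : ℝ => (x', y)) x
    ((hasDerivAt_id x).prodMk (hasDerivAt_const x y))).deriv

lemma uncurry_pd2 (f : ℝ → ℝ → ℝ) (hf : Differentiable ℝ (uncurry f)) :
    uncurry (pd2 f) = fun p => fderiv ℝ (uncurry f) p (0, 1) := by
  ext ⟨x, y⟩
  exact ((hf (x, y)).hasFDerivAt.comp_hasDerivAt (f := fun y' : ℝ => (x, y')) y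
    ((hasDerivAt_const y x).prodMk (hasDerivAt_id y))).deriv

lemma pd1_eventuallyEq {f g : ℝ → ℝ → ℝ} {p : ℝ × ℝ} (h : uncurry f =ᶠ[𝓝 p] uncurry g) :
    uncurry (pd1 f) =ᶠ[𝓝 p] uncurry (pd1 g) := by
  filter_upwards [eventually_eventually_nhds.2 h] with q hq
  have hc : Tendsto (fun x' : ℝ => (x', q.2)) (𝓝 q.1) (𝓝 q) :=
    Continuous.tendsto' (by fun_prop) _ _ rfl
  exact EventuallyEq.deriv_eq (hc.eventually hq)

lemma pd2_eventuallyEq {f g : ℝ → ℝ → ℝ} {p : ℝ × ℝ} (h : uncurry f =ᶠ[𝓝 p] uncurry g) :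
    uncurry (pd2 f) =ᶠ[𝓝 p] uncurry (pd2 g) := by
  filter_upwards [eventually_eventually_nhds.2 h] with q hq
  have hc : Tendsto (fun y' : ℝ => (q.1, y')) (𝓝 q.2) (𝓝 q) :=
    Continuous.tendsto' (by fun_prop) _ _ rfl
  exact EventuallyEq.deriv_eq (hc.eventually hq)

lemma pdMix_eventuallyEq (i j : ℕ) {f g : ℝ → ℝ → ℝ} {p : ℝ × ℝ}
    (h : uncurry f =ᶠ[𝓝 p] uncurry g) :
    uncurry (pdMix i j f) =ᶠ[𝓝 p] uncurry (pdMix i j g) := by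
  have h2 : uncurry (pd2^[j] f) =ᶠ[𝓝 p] uncurry (pd2^[j] g) := by
    induction j with
    | zero => exact h
    | succ j ih => simpa only [iterate_succ_apply'] using pd2_eventuallyEq ih
  unfold pdMix
  induction i with
  | zero => exact h2
  | succ i ih => simpa only [iterate_succ_apply'] using pd1_eventuallyEq ih

/-- A directional derivative of a convolution falls on the compactly supported factor. -/
lemma fderiv_convolution_apply {f K : ℝ × ℝ → ℝ} (hf : ContDiff ℝ 1 f)
    (hs : HasCompactSupport f) (hK : Continuous K) (v p : ℝ × ℝ) :
    fderiv ℝ (f ⋆[ContinuousLinearMap.mul ℝ ℝ, volume] K) p v =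
      ((fun q => fderiv ℝ f q v) ⋆[ContinuousLinearMap.mul ℝ ℝ, volume] K) p := by
  have hL := hK.locallyIntegrable (μ := volume)
  rw [(hs.hasFDerivAt_convolution_left (ContinuousLinearMap.mul ℝ ℝ) hf hL p).fderiv]
  have hi := (hs.fderiv (𝕜 := ℝ)).convolutionExists_left
    ((ContinuousLinearMap.mul ℝ ℝ).precompL (ℝ × ℝ)) (hf.continuous_fderiv one_ne_zero) hL p
  rw [convolution_def, ContinuousLinearMap.integral_apply hi]
  rfl

lemma iterate_directional {D : (ℝ → ℝ → ℝ) → ℝ → ℝ → ℝ} {v : ℝ × ℝ}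
    (hD : ∀ f, Differentiable ℝ (uncurry f) →
      uncurry (D f) = fun p => fderiv ℝ (uncurry f) p v)
    (k m : ℕ) {S : Set (ℝ × ℝ)} (hS : IsCompact S) {f : ℝ → ℝ → ℝ}
    (hf : ContDiff ℝ (m + k : ℕ) (uncurry f)) (hs : tsupport (uncurry f) ⊆ S) :
    ContDiff ℝ m (uncurry (D^[k] f)) ∧ tsupport (uncurry (D^[k] f)) ⊆ S ∧
      ∀ K : ℝ × ℝ → ℝ, Continuous K →
        D^[k] (curry (uncurry f ⋆[ContinuousLinearMap.mul ℝ ℝ, volume] K)) =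
          curry (uncurry (D^[k] f) ⋆[ContinuousLinearMap.mul ℝ ℝ, volume] K) := by
  induction k generalizing f with
  | zero => exact ⟨hf, hs, fun K _ => rfl⟩
  | succ k ih =>
    have h1 : ContDiff ℝ 1 (uncurry f) := hf.of_le (by exact_mod_cast (by omega : 1 ≤ m + (k + 1)))
    have hc : HasCompactSupport (uncurry f) := hS.of_isClosed_subset (isClosed_tsupport _) hs
    have hDf := hD f (h1.differentiable one_ne_zero)
    have hf' : ContDiff ℝ (m + k : ℕ) (uncurry (D f)) := by
      rw [hDf]
      exact (hf.fderiv_right (m := (m + k : ℕ)) (by norm_cast)).clm_apply contDiff_const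
    have hs' : tsupport (uncurry (D f)) ⊆ S := by
      rw [hDf]
      exact (tsupport_fderiv_apply_subset ℝ v).trans hs
    obtain ⟨a, b, c⟩ := ih hf' hs'
    refine ⟨a, b, fun K hK => ?_⟩
    rw [iterate_succ_apply, iterate_succ_apply, ← c K hK]
    congr 1
    have hd : Differentiable ℝ (uncurry f ⋆[ContinuousLinearMap.mul ℝ ℝ, volume] K) := fun p =>
      (hc.hasFDerivAt_convolution_left (ContinuousLinearMap.mul ℝ ℝ) h1
        hK.locallyIntegrable p).differentiableAt
    have := hD (curry (uncurry f ⋆[ContinuousLinearMap.mul ℝ ℝ, volume] K))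
      (by rwa [uncurry_curry])
    rw [← curry_uncurry (D _), this, hDf, uncurry_curry]
    congr 1
    ext p
    exact fderiv_convolution_apply h1 hc hK v p

lemma pdMix_convolution (i j r : ℕ) (hij : i + j ≤ r) {S : Set (ℝ × ℝ)} (hS : IsCompact S)
    {f : ℝ → ℝ → ℝ} (hf : ContDiff ℝ r (uncurry f)) (hs : tsupport (uncurry f) ⊆ S) :
    Continuous (uncurry (pdMix i j f)) ∧ tsupport (uncurry (pdMix i j f)) ⊆ S ∧
      ∀ K : ℝ × ℝ → ℝ, Continuous K →
        pdMix i j (curry (uncurry f ⋆[ContinuousLinearMap.mul ℝ ℝ, volume] K)) =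
          curry (uncurry (pdMix i j f) ⋆[ContinuousLinearMap.mul ℝ ℝ, volume] K) := by
  obtain ⟨a, b, c⟩ := iterate_directional uncurry_pd2 j i hS
    (hf.of_le (by exact_mod_cast hij)) hs
  obtain ⟨a', b', c'⟩ := iterate_directional uncurry_pd1 i 0 hS (by simpa using a) b
  refine ⟨a'.continuous, b', fun K hK => ?_⟩
  unfold pdMix
  rw [c K hK, c' K hK]

/-- The function on the plane defined by a bivariate polynomial. -/
noncomputable def planeEval (P : MvPolynomial (Fin 2) ℝ) (p : ℝ × ℝ) : ℝ :=
  MvPolynomial.eval ![p.1, p.2] P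

lemma continuous_planeEval (P : MvPolynomial (Fin 2) ℝ) : Continuous (planeEval P) := by
  refine P.continuous_eval.comp (continuous_pi fun i => ?_)
  fin_cases i
  · exact continuous_fst
  · exact continuous_snd

lemma exists_convolution_eq_planeEval (P : MvPolynomial (Fin 2) ℝ) {g : ℝ × ℝ → ℝ}
    (hg : Continuous g) (hs : HasCompactSupport g) :
    ∃ R, g ⋆[ContinuousLinearMap.mul ℝ ℝ, volume] planeEval P = planeEval R := by
  have hint : ∀ (g : ℝ × ℝ → ℝ) (_ : Continuous g) (_ : HasCompactSupport g)
      (P : MvPolynomial (Fin 2) ℝ) (z : ℝ × ℝ),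
      Integrable (fun t => g t * planeEval P (z - t)) := fun g hg hs P z =>
    (hg.mul ((continuous_planeEval P).comp (by fun_prop))).integrable_of_hasCompactSupport
      hs.mul_right
  induction P using MvPolynomial.induction_on generalizing g with
  | C a =>
    refine ⟨MvPolynomial.C (∫ t, g t * a), ?_⟩
    ext z
    simp [convolution_def, planeEval]
  | add p q hp hq =>
    obtain ⟨R₁, h₁⟩ := hp hg hs
    obtain ⟨R₂, h₂⟩ := hq hg hs
    refine ⟨R₁ + R₂, ?_⟩
    ext z
    have e₁ := congrFun h₁ z
    have e₂ := congrFun h₂ z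
    simp only [convolution_def, ContinuousLinearMap.mul_apply'] at e₁ e₂ ⊢
    have : planeEval (R₁ + R₂) z = planeEval R₁ z + planeEval R₂ z := by simp [planeEval]
    rw [this, ← e₁, ← e₂, ← integral_add (hint g hg hs p z) (hint g hg hs q z)]
    simp [planeEval, mul_add]
  | mul_X p i hp =>
    have hX : Continuous (planeEval (MvPolynomial.X i)) := continuous_planeEval _
    have hg' : Continuous fun t => planeEval (MvPolynomial.X i) t * g t := hX.mul hg
    have hs' : HasCompactSupport fun t => planeEval (MvPolynomial.X i) t * g t := hs.mul_left
    obtain ⟨R₁, h₁⟩ := hp hg hs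
    obtain ⟨R₂, h₂⟩ := hp hg' hs'
    refine ⟨MvPolynomial.X i * R₁ - R₂, ?_⟩
    ext z
    have e₁ := congrFun h₁ z
    have e₂ := congrFun h₂ z
    simp only [convolution_def, ContinuousLinearMap.mul_apply'] at e₁ e₂ ⊢
    have : planeEval (MvPolynomial.X i * R₁ - R₂) z =
        planeEval (MvPolynomial.X i) z * planeEval R₁ z - planeEval R₂ z := by simp [planeEval]
    rw [this, ← e₁, ← e₂, ← integral_const_mul,
      ← integral_sub ((hint g hg hs p z).const_mul _) (hint _ hg' hs' p z)]
    congr 1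
    ext t
    have : planeEval (MvPolynomial.X i) (z - t) =
        planeEval (MvPolynomial.X i) z - planeEval (MvPolynomial.X i) t := by
      fin_cases i <;> simp [planeEval]
    have hm : planeEval (p * MvPolynomial.X i) (z - t) =
        planeEval p (z - t) * planeEval (MvPolynomial.X i) (z - t) := by simp [planeEval]
    rw [hm, this]
    ring

/-- The bivariate Landau polynomial `(8 M² + 1 - X² - Y²) ^ k`, normalised to have integral one on
the square of half-side `2 M`. -/
noncomputable def landauKernel (M : ℝ) (k : ℕ) : MvPolynomial (Fin 2) ℝ :=
  MvPolynomial.C (∫ u in closedBall (0 : ℝ × ℝ) (2 * M),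
      (8 * M ^ 2 + 1 - u.1 ^ 2 - u.2 ^ 2) ^ k)⁻¹ *
    (MvPolynomial.C (8 * M ^ 2 + 1) - MvPolynomial.X 0 ^ 2 - MvPolynomial.X 1 ^ 2) ^ k

lemma tendsto_convolution_landauKernel {M : ℝ} (hM : 0 < M) {g : ℝ × ℝ → ℝ} (hg : Continuous g)
    (hs : tsupport g ⊆ closedBall 0 M) {ε : ℝ} (hε : 0 < ε) :
    ∀ᶠ k in atTop, ∀ z ∈ closedBall (0 : ℝ × ℝ) M,
      |g z - (g ⋆[ContinuousLinearMap.mul ℝ ℝ, volume] planeEval (landauKernel M k)) z| < ε := by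
  let c : ℝ × ℝ → ℝ := fun u => 8 * M ^ 2 + 1 - u.1 ^ 2 - u.2 ^ 2
  let s : Set (ℝ × ℝ) := closedBall 0 (2 * M)
  have hcs : IsCompact s := isCompact_closedBall _ _
  have hcc : Continuous c := by fun_prop
  have : CompactSpace (closedBall (0 : ℝ × ℝ) M) :=
    isCompact_iff_compactSpace.1 (isCompact_closedBall _ _)
  let G : C(ℝ × ℝ, C(closedBall (0 : ℝ × ℝ) M, ℝ)) :=
    ContinuousMap.curry ⟨fun q => g (q.2.1 - q.1), by fun_prop⟩
  have key := tendsto_setIntegral_pow_smul_of_unique_maximum_of_isCompact_of_continuousOn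
    (μ := volume) (x₀ := (0 : ℝ × ℝ)) (g := G) hcs hcc.continuousOn ?_ ?_ ?_ ?_
    G.continuous.continuousOn
  · filter_upwards [Metric.tendsto_nhds.1 key ε hε] with k hk z hz
    refine lt_of_le_of_lt ?_ hk
    rw [dist_comm]
    refine le_trans (le_of_eq ?_) (ContinuousMap.dist_apply_le_dist ⟨z, hz⟩)
    rw [Real.dist_eq]
    congr 2
    · simp [G]
    · have hI : IntegrableOn (fun u => c u ^ k • G u) s volume :=
        (((hcc.pow k).smul G.continuous).continuousOn).integrableOn_compact hcs
      rw [ContinuousMap.smul_apply, ContinuousMap.integral_apply hI, convolution_mul_swap,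
        smul_eq_mul, ← integral_const_mul]
      rw [← setIntegral_eq_integral_of_forall_compl_eq_zero (μ := volume) (s := s)
        (f := fun t => g (z - t) * _)]
      · refine integral_congr_ae (Eventually.of_forall fun u => ?_)
        simp [planeEval, landauKernel, G, c, s]
        ring
      · intro u hu
        have : g (z - u) = 0 := by
          by_contra h
          have h1 := hs (subset_tsupport _ h)
          refine hu ?_
          simp only [s, mem_closedBall_zero_iff] at h1 hz ⊢
          have := norm_sub_le z (z - u)
          rw [sub_sub_cancel] at this
          linarith
        rw [this, zero_mul]
  · rintro ⟨a, b⟩ - hne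
    have : 0 < a ^ 2 + b ^ 2 := by
      by_contra! h
      refine hne (Prod.ext ?_ ?_) <;> simp only [Prod.fst_zero, Prod.snd_zero] <;> nlinarith
    simp only [c, Prod.fst_zero, Prod.snd_zero]
    linarith
  · rintro ⟨a, b⟩ hab
    simp only [s, mem_closedBall_zero_iff, Prod.norm_def, sup_le_iff, Real.norm_eq_abs] at hab
    have h1 := sq_le_sq' (abs_le.1 hab.1).1 (abs_le.1 hab.1).2
    have h2 := sq_le_sq' (abs_le.1 hab.2).1 (abs_le.1 hab.2).2
    simp only [c]
    nlinarith
  · simp only [c, Prod.fst_zero, Prod.snd_zero]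
    nlinarith
  · refine subset_closure (ball_subset_interior_closedBall (mem_ball_self (by positivity)))

/-- Let `r ≥ 0` be a finite integer, `F : ℝ² → ℝ` a function of class `C^r`, and
`B` the closed (Euclidean) ball of radius `ρ` centered at the origin of `ℝ²`.
Then for every `n ≥ 1` there is a real polynomial `R_n` in two variables such that
`|∂^{i+j}F/∂x^i∂y^j (x,y) − ∂^{i+j}R_n/∂x^i∂y^j (x,y)| < 1/n` for all `(x,y) ∈ B`
and all `(i,j)` with `i + j ≤ r`. -/
theorem polynomial_Cr_approximation_on_ball
    (r : ℕ) (F : ℝ → ℝ → ℝ) (hF : ContDiff ℝ r (Function.uncurry F)) (ρ : ℝ) :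
    ∀ n : ℕ, 1 ≤ n → ∃ R : MvPolynomial (Fin 2) ℝ,
      ∀ x y : ℝ, x ^ 2 + y ^ 2 ≤ ρ ^ 2 →
        ∀ i j : ℕ, i + j ≤ r →
          |pdMix i j F x y
            - pdMix i j (fun a b => MvPolynomial.eval ![a, b] R) x y| < 1 / n := by
  intro n hn
  have hε : (0 : ℝ) < 1 / n := by positivity
  have hM : 0 < |ρ| + 2 := by positivity
  let χ : ContDiffBump (0 : ℝ × ℝ) := ⟨|ρ| + 1, |ρ| + 2, by positivity, by linarith⟩
  let f : ℝ → ℝ → ℝ := curry fun p => χ p * uncurry F p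
  have hf : ContDiff ℝ r (uncurry f) := χ.contDiff.mul hF
  have hs : tsupport (uncurry f) ⊆ closedBall 0 (|ρ| + 2) :=
    (tsupport_mul_subset_left (f := χ) (g := uncurry F)).trans χ.tsupport_eq.subset
  have hS : IsCompact (closedBall (0 : ℝ × ℝ) (|ρ| + 2)) := isCompact_closedBall _ _
  have hall : ∀ᶠ k in atTop, ∀ ij ∈ Finset.range (r + 1) ×ˢ Finset.range (r + 1),
      ij.1 + ij.2 ≤ r → ∀ z ∈ closedBall (0 : ℝ × ℝ) (|ρ| + 2),
        |uncurry (pdMix ij.1 ij.2 f) z - (uncurry (pdMix ij.1 ij.2 f)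
          ⋆[ContinuousLinearMap.mul ℝ ℝ, volume]
            planeEval (landauKernel (|ρ| + 2) k)) z| < 1 / n := by
    rw [Finset.eventually_all]
    rintro ⟨i, j⟩ -
    by_cases hij : i + j ≤ r
    · obtain ⟨a, b, -⟩ := pdMix_convolution i j r hij hS hf hs
      filter_upwards [tendsto_convolution_landauKernel hM a b hε] with k hk _ using hk
    · exact Eventually.of_forall fun k h => absurd h hij
  obtain ⟨k, hk⟩ := hall.exists
  obtain ⟨R, hR⟩ := exists_convolution_eq_planeEval (landauKernel (|ρ| + 2) k) hf.continuous
    (hS.of_isClosed_subset (isClosed_tsupport _) hs)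
  refine ⟨R, fun x y hxy i j hij => ?_⟩
  have hz : ((x, y) : ℝ × ℝ) ∈ closedBall 0 |ρ| := by
    rw [mem_closedBall_zero_iff, Prod.norm_def, sup_le_iff]
    exact ⟨sq_le_sq.1 (by nlinarith), sq_le_sq.1 (by nlinarith)⟩
  have hloc : uncurry f =ᶠ[𝓝 (x, y)] uncurry F := by
    filter_upwards [χ.eventuallyEq_one_of_mem_ball
      (closedBall_subset_ball (lt_add_one |ρ|) hz)] with p hp
    change χ p * uncurry F p = _
    rw [hp, Pi.one_apply, one_mul]
  have h := hk (i, j) (by simp; omega) hij (x, y) (closedBall_subset_closedBall (by linarith) hz)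
  obtain ⟨-, -, hconv⟩ := pdMix_convolution i j r hij hS hf hs
  have hc := hconv _ (continuous_planeEval (landauKernel (|ρ| + 2) k))
  rw [hR] at hc
  rw [(pdMix_eventuallyEq i j hloc).eq_of_nhds] at h
  rw [show (fun a b => MvPolynomial.eval ![a, b] R) = curry (planeEval R) from rfl, hc]
  exact h
end

section
/- Let X = (P,Q) be a C¹ vector field on ℝ² and let γ : ℝ → ℝ² be a T-periodic solution of X (with T > 0) satisfying ∫₀^T div X(γ(t)) dt = 0. Let F : ℝ² → ℝ be of class C² with F(γ(t)) = 0 and ∇F(γ(t)) ≠ (0,0) for all t ∈ ℝ, let B ⊂ ℝ² be a closed ball whose interior contains γ([0,T]), and let (R_n) be a sequence of real polynomials in two variables such that R_n and all of its partial derivatives of total order ≤ 2 converge uniformly on B to F and its corresponding partial derivatives. Then for every λ > 0, lim_{n→∞} ∫₀^T div(X + λR_n∇R_n)(γ(t)) dt = λ ∫₀^T ‖∇F(γ(t))‖² dt > 0; in particular, ∫₀^T div(X + λR_n∇R_n)(γ(t)) dt > 0 for all sufficiently large n. -/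
open Filter

/-- The two-variable function associated to a polynomial in two variables. -/
noncomputable def mvFun (R : MvPolynomial (Fin 2) ℝ) : ℝ → ℝ → ℝ :=
  fun a b => MvPolynomial.eval ![a, b] R

section PartialDerivatives

variable {f : ℝ → ℝ → ℝ}

theorem hasDerivAt_pd1 {x y : ℝ} (hf : DifferentiableAt ℝ (Function.uncurry f) (x, y)) :
    HasDerivAt (fun x' => f x' y) (pd1 f x y) x := by
  have h : DifferentiableAt ℝ (fun x' => Function.uncurry f (x', y)) x :=
    DifferentiableAt.comp (g := Function.uncurry f) x hf (by fun_prop)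
  exact h.hasDerivAt

theorem hasDerivAt_pd2 {x y : ℝ} (hf : DifferentiableAt ℝ (Function.uncurry f) (x, y)) :
    HasDerivAt (fun y' => f x y') (pd2 f x y) y := by
  have h : DifferentiableAt ℝ (fun y' => Function.uncurry f (x, y')) y :=
    DifferentiableAt.comp (g := Function.uncurry f) y hf (by fun_prop)
  exact h.hasDerivAt

theorem ContDiff.uncurry_pd1 {m n : WithTop ℕ∞} (hf : ContDiff ℝ n (Function.uncurry f))
    (hmn : m + 1 ≤ n) : ContDiff ℝ m (Function.uncurry (pd1 f)) := by
  have hd : Differentiable ℝ (Function.uncurry f) :=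
    (hf.of_le (le_trans le_add_self hmn)).differentiable one_ne_zero
  have h : Function.uncurry (pd1 f) = fun p => fderiv ℝ (Function.uncurry f) p (1, 0) := by
    ext ⟨x, y⟩
    have h1 : HasDerivAt (fun x' : ℝ => (x', y)) ((1 : ℝ), (0 : ℝ)) x :=
      (hasDerivAt_id x).prodMk (hasDerivAt_const x y)
    exact ((hd (x, y)).hasFDerivAt.comp_hasDerivAt x h1).deriv
  rw [h]
  exact (hf.fderiv_right hmn).clm_apply contDiff_const

theorem ContDiff.uncurry_pd2 {m n : WithTop ℕ∞} (hf : ContDiff ℝ n (Function.uncurry f))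
    (hmn : m + 1 ≤ n) : ContDiff ℝ m (Function.uncurry (pd2 f)) := by
  have hd : Differentiable ℝ (Function.uncurry f) :=
    (hf.of_le (le_trans le_add_self hmn)).differentiable one_ne_zero
  have h : Function.uncurry (pd2 f) = fun p => fderiv ℝ (Function.uncurry f) p (0, 1) := by
    ext ⟨x, y⟩
    have h1 : HasDerivAt (fun y' : ℝ => (x, y')) ((0 : ℝ), (1 : ℝ)) y :=
      (hasDerivAt_const y x).prodMk (hasDerivAt_id y)
    exact ((hd (x, y)).hasFDerivAt.comp_hasDerivAt y h1).deriv
  rw [h]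
  exact (hf.fderiv_right hmn).clm_apply contDiff_const

theorem contDiff_uncurry_mvFun {n : WithTop ℕ∞} (R : MvPolynomial (Fin 2) ℝ) :
    ContDiff ℝ n (Function.uncurry (mvFun R)) := by
  induction R using MvPolynomial.induction_on with
  | C a =>
    have h : Function.uncurry (mvFun (MvPolynomial.C a)) = fun _ => a := by
      ext ⟨x, y⟩
      simp [mvFun]
    rw [h]
    exact contDiff_const
  | add p q hp hq =>
    have h : Function.uncurry (mvFun (p + q)) =
        fun z => Function.uncurry (mvFun p) z + Function.uncurry (mvFun q) z := by
      ext ⟨x, y⟩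
      simp [mvFun]
    rw [h]
    exact hp.add hq
  | mul_X p i hp =>
    have h : Function.uncurry (mvFun (p * MvPolynomial.X i)) =
        fun z => Function.uncurry (mvFun p) z * (![z.1, z.2] i) := by
      ext ⟨x, y⟩
      simp [mvFun]
    rw [h]
    refine hp.mul ?_
    fin_cases i
    · exact contDiff_fst
    · exact contDiff_snd

/-- The divergence of `X + λ G ∇G`, expanded by the product rule. -/
theorem div_add_smul_mul_grad {P Q G : ℝ → ℝ → ℝ} (hP : ContDiff ℝ 1 (Function.uncurry P))
    (hQ : ContDiff ℝ 1 (Function.uncurry Q)) (hG : ContDiff ℝ 2 (Function.uncurry G))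
    (lam x y : ℝ) :
    pd1 (fun x y => P x y + lam * G x y * pd1 G x y) x y
        + pd2 (fun x y => Q x y + lam * G x y * pd2 G x y) x y
      = (pd1 P x y + pd2 Q x y) + lam * (pd1 G x y ^ 2 + pd2 G x y ^ 2
        + G x y * (pd1 (pd1 G) x y + pd2 (pd2 G) x y)) := by
  have hG' := hG.differentiable two_ne_zero (x, y)
  have h11 := (hG.uncurry_pd1 (m := 1) one_add_one_eq_two.le).differentiable one_ne_zero (x, y)
  have h22 := (hG.uncurry_pd2 (m := 1) one_add_one_eq_two.le).differentiable one_ne_zero (x, y)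
  have e1 : pd1 (fun x y => P x y + lam * G x y * pd1 G x y) x y = _ :=
    ((hasDerivAt_pd1 (hP.differentiable one_ne_zero (x, y))).add
      (((hasDerivAt_pd1 hG').const_mul lam).mul (hasDerivAt_pd1 h11))).deriv
  have e2 : pd2 (fun x y => Q x y + lam * G x y * pd2 G x y) x y = _ :=
    ((hasDerivAt_pd2 (hQ.differentiable one_ne_zero (x, y))).add
      (((hasDerivAt_pd2 hG').const_mul lam).mul (hasDerivAt_pd2 h22))).deriv
  rw [e1, e2]
  ring

end PartialDerivatives

/-- A uniformly convergent sequence with continuous limit is eventually uniformly bounded on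
compact sets. -/
theorem TendstoUniformlyOn.exists_eventually_abs_le {α : Type*} [TopologicalSpace α]
    {f : ℕ → α → ℝ} {g : α → ℝ} {K : Set α} (h : TendstoUniformlyOn f g atTop K)
    (hK : IsCompact K) (hg : ContinuousOn g K) :
    ∃ C, ∀ᶠ n in atTop, ∀ x ∈ K, |f n x| ≤ C := by
  obtain ⟨C, hC⟩ := hK.exists_bound_of_continuousOn hg
  refine ⟨C + 1, ?_⟩
  filter_upwards [Metric.tendstoUniformlyOn_iff.1 h 1 one_pos] with n hn x hx
  have h1 := hn x hx
  have h2 := hC x hx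
  rw [dist_comm, Real.dist_eq] at h1
  rw [Real.norm_eq_abs] at h2
  have h3 := abs_add_le (f n x - g x) (g x)
  rw [sub_add_cancel] at h3
  linarith

/-- Convergence of the integral of the expanded divergence, along a curve parametrised by
`[0, T]`. -/
theorem tendsto_integral_add_mul_of_tendstoUniformlyOn {T : ℝ} (hT : 0 ≤ T) (lam : ℝ)
    {D a b u v w : ℝ → ℝ} {a' b' u' v' w' : ℕ → ℝ → ℝ} (hD : Continuous D)
    (ha : Continuous a) (hb : Continuous b) (hu : Continuous u) (hv : Continuous v)
    (hw : Continuous w)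
    (ha' : ∀ n, Continuous (a' n)) (hb' : ∀ n, Continuous (b' n)) (hu' : ∀ n, Continuous (u' n))
    (hv' : ∀ n, Continuous (v' n)) (hw' : ∀ n, Continuous (w' n))
    (hta : TendstoUniformlyOn a' a atTop (Set.Icc 0 T))
    (htb : TendstoUniformlyOn b' b atTop (Set.Icc 0 T))
    (htu : TendstoUniformlyOn u' u atTop (Set.Icc 0 T))
    (htv : TendstoUniformlyOn v' v atTop (Set.Icc 0 T))
    (htw : TendstoUniformlyOn w' w atTop (Set.Icc 0 T)) :
    Tendsto (fun n => ∫ t in (0 : ℝ)..T,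
        (D t + lam * (a' n t ^ 2 + b' n t ^ 2 + u' n t * (v' n t + w' n t)))) atTop
      (nhds (∫ t in (0 : ℝ)..T, (D t + lam * (a t ^ 2 + b t ^ 2 + u t * (v t + w t))))) := by
  obtain ⟨A, hA⟩ := hta.exists_eventually_abs_le isCompact_Icc ha.continuousOn
  obtain ⟨A₂, hA₂⟩ := htb.exists_eventually_abs_le isCompact_Icc hb.continuousOn
  obtain ⟨U, hU⟩ := htu.exists_eventually_abs_le isCompact_Icc hu.continuousOn
  obtain ⟨V, hV⟩ := htv.exists_eventually_abs_le isCompact_Icc hv.continuousOn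
  obtain ⟨W, hW⟩ := htw.exists_eventually_abs_le isCompact_Icc hw.continuousOn
  have hmem : ∀ t ∈ Set.uIoc 0 T, t ∈ Set.Icc 0 T := fun t ht =>
    Set.Ioc_subset_Icc_self (Set.uIoc_of_le hT ▸ ht)
  refine intervalIntegral.tendsto_integral_filter_of_dominated_convergence
    (fun t => |D t| + |lam| * (A ^ 2 + A₂ ^ 2 + U * (V + W))) ?_ ?_ ?_ ?_
  · refine Eventually.of_forall fun n => Continuous.aestronglyMeasurable ?_
    have := ha' n
    have := hb' n
    have := hu' n
    have := hv' n
    have := hw' n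
    fun_prop
  · filter_upwards [hA, hA₂, hU, hV, hW] with n h1 h2 h3 h4 h5
    refine Eventually.of_forall fun t ht => ?_
    have ht' := hmem t ht
    have hU0 : 0 ≤ U := (abs_nonneg _).trans (h3 t ht')
    have e1 : |a' n t ^ 2| ≤ A ^ 2 := by
      rw [abs_pow]
      exact pow_le_pow_left₀ (abs_nonneg _) (h1 t ht') 2
    have e2 : |b' n t ^ 2| ≤ A₂ ^ 2 := by
      rw [abs_pow]
      exact pow_le_pow_left₀ (abs_nonneg _) (h2 t ht') 2
    have e3 : |u' n t * (v' n t + w' n t)| ≤ U * (V + W) := by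
      rw [abs_mul]
      exact mul_le_mul (h3 t ht')
        ((abs_add_le _ _).trans (add_le_add (h4 t ht') (h5 t ht'))) (abs_nonneg _) hU0
    rw [Real.norm_eq_abs]
    refine (abs_add_le _ _).trans ?_
    rw [abs_mul]
    gcongr
    exact (abs_add_le _ _).trans (add_le_add ((abs_add_le _ _).trans (add_le_add e1 e2)) e3)
  · exact Continuous.intervalIntegrable (by fun_prop) _ _
  · refine Eventually.of_forall fun t ht => ?_
    have ht' := hmem t ht
    exact (((((hta.tendsto_at ht').pow 2).add ((htb.tendsto_at ht').pow 2)).add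
      ((htu.tendsto_at ht').mul ((htv.tendsto_at ht').add (htw.tendsto_at ht')))).const_mul
        lam).const_add (D t)

/-- Let `X = (P,Q)` be a `C¹` vector field on `ℝ²`, `γ` a `T`-periodic solution
of `X` (`T > 0`) with `∫₀ᵀ div X (γ(t)) dt = 0`. Let `F : ℝ² → ℝ` be `C²` with
`F(γ(t)) = 0` and `∇F(γ(t)) ≠ (0,0)` for all `t`, let `B` be a closed
(Euclidean) ball whose interior contains `γ([0,T])`, and let `Rₙ` be real
polynomials in two variables whose partial derivatives of total order `≤ 2`
converge uniformly on `B` to the corresponding partial derivatives of `F`.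
Then for every `λ > 0`,
`lim_{n→∞} ∫₀ᵀ div(X + λRₙ∇Rₙ)(γ(t)) dt = λ ∫₀ᵀ ‖∇F(γ(t))‖² dt > 0`;
in particular `∫₀ᵀ div(X + λRₙ∇Rₙ)(γ(t)) dt > 0` for all sufficiently
large `n`. -/
theorem div_perturbed_by_polynomials_eventually_pos
    (P Q F : ℝ → ℝ → ℝ)
    (hP : ContDiff ℝ 1 (Function.uncurry P))
    (hQ : ContDiff ℝ 1 (Function.uncurry Q))
    (hF : ContDiff ℝ 2 (Function.uncurry F))
    (T : ℝ) (hT : 0 < T) (γ : ℝ → ℝ × ℝ)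
    (hper : ∀ t, γ (t + T) = γ t)
    (hsol : ∀ t, HasDerivAt γ (P (γ t).1 (γ t).2, Q (γ t).1 (γ t).2) t)
    (hdiv0 : (∫ t in (0:ℝ)..T, (pd1 P (γ t).1 (γ t).2 + pd2 Q (γ t).1 (γ t).2)) = 0)
    (hFγ : ∀ t, F (γ t).1 (γ t).2 = 0)
    (hgrad : ∀ t, (pd1 F (γ t).1 (γ t).2, pd2 F (γ t).1 (γ t).2) ≠ (0, 0))
    (c : ℝ × ℝ) (ρ : ℝ) (B : Set (ℝ × ℝ))
    (hB : B = {p : ℝ × ℝ | (p.1 - c.1) ^ 2 + (p.2 - c.2) ^ 2 ≤ ρ ^ 2})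
    (hγB : γ '' Set.Icc 0 T ⊆ interior B)
    (R : ℕ → MvPolynomial (Fin 2) ℝ)
    (hR : ∀ i j : ℕ, i + j ≤ 2 →
      TendstoUniformlyOn
        (fun n => fun p : ℝ × ℝ => pdMix i j (mvFun (R n)) p.1 p.2)
        (fun p : ℝ × ℝ => pdMix i j F p.1 p.2) atTop B) :
    ∀ lam : ℝ, 0 < lam →
      Tendsto
        (fun n => ∫ t in (0:ℝ)..T,
          (pd1 (fun x y => P x y + lam * mvFun (R n) x y * pd1 (mvFun (R n)) x y)
              (γ t).1 (γ t).2
            + pd2 (fun x y => Q x y + lam * mvFun (R n) x y * pd2 (mvFun (R n)) x y)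
              (γ t).1 (γ t).2))
        atTop
        (nhds (lam * ∫ t in (0:ℝ)..T,
          ((pd1 F (γ t).1 (γ t).2) ^ 2 + (pd2 F (γ t).1 (γ t).2) ^ 2)))
      ∧ 0 < lam * ∫ t in (0:ℝ)..T,
          ((pd1 F (γ t).1 (γ t).2) ^ 2 + (pd2 F (γ t).1 (γ t).2) ^ 2)
      ∧ ∀ᶠ n in atTop,
          0 < ∫ t in (0:ℝ)..T,
            (pd1 (fun x y => P x y + lam * mvFun (R n) x y * pd1 (mvFun (R n)) x y)
                (γ t).1 (γ t).2
              + pd2 (fun x y => Q x y + lam * mvFun (R n) x y * pd2 (mvFun (R n)) x y)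
                (γ t).1 (γ t).2) := by
  intro lam hlam
  have hγ : Continuous γ := continuous_iff_continuousAt.2 fun t => (hsol t).continuousAt
  have along : ∀ {f : ℝ → ℝ → ℝ}, ContDiff ℝ 0 (Function.uncurry f) →
      Continuous fun t => f (γ t).1 (γ t).2 := fun hf => hf.continuous.comp hγ
  have two : (1 : WithTop ℕ∞) + 1 ≤ 2 := one_add_one_eq_two.le
  have one : (0 : WithTop ℕ∞) + 1 ≤ 1 := (zero_add 1).le
  have hsub : ∀ i j : ℕ, i + j ≤ 2 → TendstoUniformlyOn
      (fun n t => pdMix i j (mvFun (R n)) (γ t).1 (γ t).2)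
      (fun t => pdMix i j F (γ t).1 (γ t).2) atTop (Set.Icc 0 T) := fun i j hij =>
    ((hR i j hij).comp γ).mono fun t ht =>
      show γ t ∈ B from interior_subset (hγB ⟨t, ht, rfl⟩)
  have hG : ∀ n, ContDiff ℝ 2 (Function.uncurry (mvFun (R n))) := fun n =>
    contDiff_uncurry_mvFun (R n)
  have hD : Continuous fun t => pd1 P (γ t).1 (γ t).2 + pd2 Q (γ t).1 (γ t).2 :=
    (along (hP.uncurry_pd1 one)).add (along (hQ.uncurry_pd2 one))
  have h1F := hF.uncurry_pd1 two
  have h2F := hF.uncurry_pd2 two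
  have c1 := along (h1F.of_le zero_le_one)
  have c2 := along (h2F.of_le zero_le_one)
  have hS : Continuous fun t => pd1 F (γ t).1 (γ t).2 ^ 2 + pd2 F (γ t).1 (γ t).2 ^ 2 :=
    (c1.pow 2).add (c2.pow 2)
  have hlim := tendsto_integral_add_mul_of_tendstoUniformlyOn hT.le lam hD
    c1 c2 (along (hF.of_le zero_le_two)) (along (h1F.uncurry_pd1 one)) (along (h2F.uncurry_pd2 one))
    (fun n => along (((hG n).uncurry_pd1 two).of_le zero_le_one))
    (fun n => along (((hG n).uncurry_pd2 two).of_le zero_le_one))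
    (fun n => along ((hG n).of_le zero_le_two))
    (fun n => along (((hG n).uncurry_pd1 two).uncurry_pd1 one))
    (fun n => along (((hG n).uncurry_pd2 two).uncurry_pd2 one))
    (hsub 1 0 (by norm_num)) (hsub 0 1 (by norm_num)) (hsub 0 0 (by norm_num))
    (hsub 2 0 (by norm_num)) (hsub 0 2 (by norm_num))
  have hval : (∫ t in (0 : ℝ)..T, ((pd1 P (γ t).1 (γ t).2 + pd2 Q (γ t).1 (γ t).2)
        + lam * (pd1 F (γ t).1 (γ t).2 ^ 2 + pd2 F (γ t).1 (γ t).2 ^ 2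
          + F (γ t).1 (γ t).2
            * (pd1 (pd1 F) (γ t).1 (γ t).2 + pd2 (pd2 F) (γ t).1 (γ t).2))))
      = lam * ∫ t in (0 : ℝ)..T,
          (pd1 F (γ t).1 (γ t).2 ^ 2 + pd2 F (γ t).1 (γ t).2 ^ 2) := by
    simp only [hFγ, zero_mul, add_zero]
    rw [intervalIntegral.integral_add (hD.intervalIntegrable _ _)
      ((hS.const_mul lam).intervalIntegrable _ _), hdiv0, zero_add,
      intervalIntegral.integral_const_mul]
  rw [hval] at hlim
  have hpos : 0 < lam * ∫ t in (0 : ℝ)..T,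
      (pd1 F (γ t).1 (γ t).2 ^ 2 + pd2 F (γ t).1 (γ t).2 ^ 2) := by
    refine mul_pos hlam (intervalIntegral.intervalIntegral_pos_of_pos
      (hS.intervalIntegrable _ _) (fun t => ?_) hT)
    by_cases h : pd1 F (γ t).1 (γ t).2 = 0
    · have h' : pd2 F (γ t).1 (γ t).2 ≠ 0 := fun h' => hgrad t (by rw [h, h'])
      positivity
    · positivity
  simp only [div_add_smul_mul_grad hP hQ (hG _)]
  exact ⟨hlim, hpos, hlim.eventually_const_lt hpos⟩
end
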